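/- Let H ⊂ ℂ be a rectangle and let μ be a Borel probability measure on H. With W(μ) := inf_{k,ε} limsup_{d→∞} sup { |VDM_d(λ)|^{2/(d(d−1))} : λ ∈ G̃_d(μ,k,ε) }, one has the upper bound log W(μ) ≤ Σ(μ), where both sides take values in [−∞, ∞). -/

import Mathlib

open MeasureTheory Filter Set
open scoped ENNReal NNReal Topology BigOperators

noncomputable section

/-- Extended logarithm on `ℝ≥0∞`, with `elog 0 = ⊥` and `elog ⊤ = ⊤`. -/
def elog (x : ℝ≥0∞) : EReal :=
  if x = 0 then ⊥ else if x = ⊤ then ⊤ else ((Real.log x.toReal : ℝ) : EReal)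

/-- The empirical measure `κ_d(λ) = (1/d) ∑_j δ_{λ_j}`. -/
def empMeasure (d : ℕ) (l : Fin d → ℂ) : MeasureTheory.Measure ℂ :=
  (d : ℝ≥0∞)⁻¹ • ∑ j : Fin d, MeasureTheory.Measure.dirac (l j)

/-- The weak* moment neighborhood `G(μ,k,ε)`: Borel probability measures on `E` whose
real moments of total order `≤ k` are within `ε` of those of `μ`. -/
def momentNbhd (E : Set ℂ) (μ : MeasureTheory.Measure ℂ) (k : ℕ) (ε : ℝ) :
    Set (MeasureTheory.Measure ℂ) :=
  {ν | MeasureTheory.IsProbabilityMeasure ν ∧ ν Eᶜ = 0 ∧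
    ∀ n₁ n₂ : ℕ, n₁ + n₂ ≤ k →
      |(∫ z, z.re ^ n₁ * z.im ^ n₂ ∂μ) - ∫ z, z.re ^ n₁ * z.im ^ n₂ ∂ν| < ε}

/-- `G̃_d(μ,k,ε) = {λ ∈ E^d : κ_d(λ) ∈ G(μ,k,ε)}`. -/
def GT (E : Set ℂ) (d : ℕ) (μ : MeasureTheory.Measure ℂ) (k : ℕ) (ε : ℝ) :
    Set (Fin d → ℂ) :=
  {l | (∀ j, l j ∈ E) ∧ empMeasure d l ∈ momentNbhd E μ k ε}

/-- The VanDerMonde determinant `VDM_d(λ) = ∏_{i<j} (λ_i - λ_j)`. -/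
def vdm (d : ℕ) (l : Fin d → ℂ) : ℂ :=
  ∏ i : Fin d, ∏ j ∈ Finset.Ioi i, (l i - l j)

/-- The weighted VanDerMonde `VDM^w_d(λ) = VDM_d(λ) ∏_i w(λ_i)^d`. -/
def vdmW (w : ℂ → ℝ) (d : ℕ) (l : Fin d → ℂ) : ℂ :=
  vdm d l * ∏ i : Fin d, (w (l i) : ℂ) ^ d

/-- A (compact, axis-parallel, nondegenerate) rectangle in `ℂ ≅ ℝ²`. -/
def IsRectangle (H : Set ℂ) : Prop :=
  ∃ a b c e : ℝ, a < b ∧ c < e ∧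
    H = {z : ℂ | z.re ∈ Set.Icc a b ∧ z.im ∈ Set.Icc c e}

/-- The free entropy `Σ(μ) = ∫∫ log|z-t| dμ(z)dμ(t)`, with values in `[-∞,∞)` for
compactly supported `μ` (positive part minus negative part, as an extended real). -/
def freeEntropy (μ : MeasureTheory.Measure ℂ) : EReal :=
  (((∫⁻ p : ℂ × ℂ, ENNReal.ofReal (Real.log ‖p.1 - p.2‖) ∂(μ.prod μ)).toReal : ℝ) : EReal)
    - ((∫⁻ p : ℂ × ℂ, ENNReal.ofReal (-Real.log ‖p.1 - p.2‖) ∂(μ.prod μ) : ℝ≥0∞) : EReal)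

/-- The density condition (3.10): `τ(D(z₀,r)) ≥ r^T` for all `z₀ ∈ E` and `0 < r ≤ r₀`. -/
def DensityCond (E : Set ℂ) (τ : MeasureTheory.Measure ℂ) : Prop :=
  ∃ T : ℝ, 0 < T ∧ ∃ r₀ : ℝ, 0 < r₀ ∧ ∀ z₀ ∈ E, ∀ r : ℝ, 0 < r → r ≤ r₀ →
    ENNReal.ofReal (r ^ T) ≤ τ (Metric.closedBall z₀ r)

/-- `J^φ_d(μ,k,ε) = ∫_{G̃_d(μ,k,ε)} |VDM^φ_d(λ)|² dτ(λ₁)⋯dτ(λ_d)`. -/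
def Jint (H : Set ℂ) (τ : MeasureTheory.Measure ℂ) (φ : ℂ → ℝ)
    (μ : MeasureTheory.Measure ℂ) (k : ℕ) (ε : ℝ) (d : ℕ) : ℝ≥0∞ :=
  ∫⁻ l in GT H d μ k ε, ENNReal.ofReal (‖vdmW φ d l‖ ^ 2)
    ∂(MeasureTheory.Measure.pi fun _ : Fin d => τ)

/-- The sup norm `‖p‖_H` of a two-variable real polynomial over `H ⊂ ℂ ≅ ℝ²`. -/
def supOn (H : Set ℂ) (p : MvPolynomial (Fin 2) ℝ) : ℝ :=
  sSup ((fun z : ℂ => |MvPolynomial.eval ![z.re, z.im] p|) '' H)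

/-- The Euclidean norm of the gradient of a two-variable real polynomial at `z ∈ ℂ ≅ ℝ²`. -/
def gradNorm (p : MvPolynomial (Fin 2) ℝ) (z : ℂ) : ℝ :=
  Real.sqrt ((MvPolynomial.eval ![z.re, z.im] (MvPolynomial.pderiv 0 p)) ^ 2 +
    (MvPolynomial.eval ![z.re, z.im] (MvPolynomial.pderiv 1 p)) ^ 2)

/-- Evaluation of a polynomial in `2d` real variables at a point of `ℂ^d ≅ (ℝ²)^d`. -/
def evalPt (d : ℕ) (P : MvPolynomial (Fin d × Fin 2) ℝ) (l : Fin d → ℂ) : ℝ :=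
  MvPolynomial.eval (fun q : Fin d × Fin 2 => ![(l q.1).re, (l q.1).im] q.2) P

/-- `W_d(μ,k,ε) = sup { |VDM_d(λ)|^{2/(d(d−1))} : λ ∈ G̃_d(μ,k,ε) }`. -/
def Wd (H : Set ℂ) (μ : MeasureTheory.Measure ℂ) (k : ℕ) (ε : ℝ) (d : ℕ) : ℝ≥0∞ :=
  ⨆ l ∈ GT H d μ k ε, ENNReal.ofReal (‖vdm d l‖ ^ (2 / ((d : ℝ) * ((d : ℝ) - 1))))

/-- The monomials `(re z)^a (im z)^b (re t)^c (im t)^e` on `ℂ × ℂ`, as a multiplicative submonoid. -/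
def pairMonomials : Submonoid C(ℂ × ℂ, ℝ) where
  carrier := {f | ∃ a b c e : ℕ, ∀ p : ℂ × ℂ,
    f p = (p.1.re ^ a * p.1.im ^ b) * (p.2.re ^ c * p.2.im ^ e)}
  one_mem' := ⟨0, 0, 0, 0, fun p => by simp⟩
  mul_mem' := by
    rintro f g ⟨a, b, c, e, hf⟩ ⟨a', b', c', e', hg⟩
    refine ⟨a + a', b + b', c + c', e + e', fun p => ?_⟩
    rw [ContinuousMap.mul_apply, hf, hg]
    ring

theorem separatesPoints_adjoin_pairMonomials :
    (Algebra.adjoin ℝ (pairMonomials : Set C(ℂ × ℂ, ℝ))).SeparatesPoints := by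
  intro p q hpq
  by_contra! h
  have key : ∀ a b c e : ℕ, (p.1.re ^ a * p.1.im ^ b) * (p.2.re ^ c * p.2.im ^ e) =
      (q.1.re ^ a * q.1.im ^ b) * (q.2.re ^ c * q.2.im ^ e) := fun a b c e =>
    h _ ⟨⟨fun p : ℂ × ℂ => (p.1.re ^ a * p.1.im ^ b) * (p.2.re ^ c * p.2.im ^ e), by fun_prop⟩,
      Algebra.subset_adjoin ⟨a, b, c, e, fun _ => rfl⟩, rfl⟩
  have h1 := key 1 0 0 0
  have h2 := key 0 1 0 0
  have h3 := key 0 0 1 0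
  have h4 := key 0 0 0 1
  simp only [pow_zero, pow_one, one_mul, mul_one] at h1 h2 h3 h4
  exact hpq (Prod.ext (Complex.ext h1 h2) (Complex.ext h3 h4))

theorem prod_restrict_eq_self {H : Set ℂ} {ν : Measure ℂ} [SFinite ν] (hν : ν Hᶜ = 0) :
    (ν.prod ν).restrict (H ×ˢ H) = ν.prod ν := by
  rw [← Measure.prod_restrict, Measure.restrict_eq_self_of_ae_mem (mem_ae_iff.2 hν)]

theorem integrable_prod_of_continuous {H : Set ℂ} (hH : IsCompact H) {ν : Measure ℂ}
    [IsFiniteMeasure ν] (hν : ν Hᶜ = 0) {f : ℂ × ℂ → ℝ} (hf : Continuous f) :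
    Integrable f (ν.prod ν) := by
  rw [← prod_restrict_eq_self hν]
  exact hf.continuousOn.integrableOn_compact (hH.prod hH)

/-- The filter of weak* moment neighborhoods of `μ`. -/
def momentFilter (H : Set ℂ) (μ : Measure ℂ) : Filter (Measure ℂ) :=
  ⨅ n : ℕ, 𝓟 (momentNbhd H μ n (1 / (n + 1)))

theorem momentNbhd_mono {H : Set ℂ} {μ : Measure ℂ} {k l : ℕ} (hkl : k ≤ l) {ε δ : ℝ} (h : δ ≤ ε) :
    momentNbhd H μ l δ ⊆ momentNbhd H μ k ε := fun _ ⟨h1, h2, h3⟩ =>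
  ⟨h1, h2, fun a b hab => (h3 a b (hab.trans hkl)).trans_le h⟩

theorem momentFilter_hasBasis (H : Set ℂ) (μ : Measure ℂ) :
    (momentFilter H μ).HasBasis (fun _ : ℕ => True) fun n => momentNbhd H μ n (1 / (n + 1)) :=
  hasBasis_iInf_principal (directed_of_isDirected_le fun _ _ h =>
    momentNbhd_mono h (Nat.one_div_le_one_div h))

theorem eventually_momentFilter (H : Set ℂ) (μ : Measure ℂ) :
    ∀ᶠ ν in momentFilter H μ, IsProbabilityMeasure ν ∧ ν Hᶜ = 0 :=
  (momentFilter_hasBasis H μ).eventually_iff.2 ⟨0, trivial, fun _ h => ⟨h.1, h.2.1⟩⟩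

theorem tendsto_moment (H : Set ℂ) (μ : Measure ℂ) (a b : ℕ) :
    Tendsto (fun ν : Measure ℂ => ∫ z, z.re ^ a * z.im ^ b ∂ν) (momentFilter H μ)
      (𝓝 (∫ z, z.re ^ a * z.im ^ b ∂μ)) := by
  rw [Metric.tendsto_nhds]
  intro ε hε
  obtain ⟨n, hn⟩ := exists_nat_one_div_lt hε
  refine (momentFilter_hasBasis H μ).eventually_iff.2 ⟨max n (a + b), trivial, fun ν hν => ?_⟩
  rw [dist_comm, Real.dist_eq]
  exact (hν.2.2 a b (le_max_right _ _)).trans_le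
    ((Nat.one_div_le_one_div (le_max_left _ _)).trans hn.le)

theorem tendsto_integral_adjoin {H : Set ℂ} (hH : IsCompact H) {μ : Measure ℂ}
    [IsProbabilityMeasure μ] (hμH : μ Hᶜ = 0) {f : C(ℂ × ℂ, ℝ)}
    (hf : f ∈ Algebra.adjoin ℝ (pairMonomials : Set C(ℂ × ℂ, ℝ))) :
    Tendsto (fun ν : Measure ℂ => ∫ p, f p ∂(ν.prod ν)) (momentFilter H μ)
      (𝓝 (∫ p, f p ∂(μ.prod μ))) := by
  rw [← Subalgebra.mem_toSubmodule, Algebra.adjoin_eq_span, Submonoid.closure_eq] at hf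
  induction hf using Submodule.span_induction with
  | mem f hf =>
    obtain ⟨a, b, c, e, hf⟩ := hf
    have key : ∀ ν : Measure ℂ, IsProbabilityMeasure ν → ∫ p, f p ∂(ν.prod ν) =
        (∫ z, z.re ^ a * z.im ^ b ∂ν) * ∫ z, z.re ^ c * z.im ^ e ∂ν := fun ν _ => by
      simp_rw [hf]
      exact integral_prod_mul (μ := ν) (ν := ν) (fun z : ℂ => z.re ^ a * z.im ^ b)
        (fun z : ℂ => z.re ^ c * z.im ^ e)
    rw [key μ inferInstance]
    refine ((tendsto_moment H μ a b).mul (tendsto_moment H μ c e)).congr' ?_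
    filter_upwards [eventually_momentFilter H μ] with ν hν using (key ν hν.1).symm
  | zero => simp [tendsto_const_nhds]
  | add f g _ _ hf hg =>
    have key : ∀ ν : Measure ℂ, IsProbabilityMeasure ν → ν Hᶜ = 0 →
        ∫ p, (f + g) p ∂(ν.prod ν) = ∫ p, f p ∂(ν.prod ν) + ∫ p, g p ∂(ν.prod ν) := fun ν _ h =>
      integral_add (integrable_prod_of_continuous hH h f.continuous)
        (integrable_prod_of_continuous hH h g.continuous)
    rw [key μ inferInstance hμH]
    refine (hf.add hg).congr' ?_
    filter_upwards [eventually_momentFilter H μ] with ν hν using (key ν hν.1 hν.2).symm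
  | smul r f _ hf =>
    simp only [ContinuousMap.smul_apply, integral_smul]
    exact hf.const_smul r

theorem abs_integral_prod_sub_le {H : Set ℂ} (hH : IsCompact H) {ν : Measure ℂ}
    [IsProbabilityMeasure ν] (hν : ν Hᶜ = 0) {f g : C(ℂ × ℂ, ℝ)} {δ : ℝ}
    (h : ∀ p ∈ H ×ˢ H, ‖f p - g p‖ ≤ δ) :
    |∫ p, f p ∂(ν.prod ν) - ∫ p, g p ∂(ν.prod ν)| ≤ δ := by
  rw [← integral_sub (integrable_prod_of_continuous hH hν f.continuous)
    (integrable_prod_of_continuous hH hν g.continuous), ← Real.norm_eq_abs,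
    ← prod_restrict_eq_self hν]
  refine (norm_setIntegral_le_of_norm_le_const (measure_lt_top _ _) h).trans_eq ?_
  rw [← measureReal_restrict_apply_univ, prod_restrict_eq_self hν]
  simp

theorem tendsto_integral_momentFilter {H : Set ℂ} (hH : IsCompact H) {μ : Measure ℂ}
    [IsProbabilityMeasure μ] (hμH : μ Hᶜ = 0) (g : C(ℂ × ℂ, ℝ)) :
    Tendsto (fun ν : Measure ℂ => ∫ p, g p ∂(ν.prod ν)) (momentFilter H μ)
      (𝓝 (∫ p, g p ∂(μ.prod μ))) := by
  rw [Metric.tendsto_nhds]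
  intro ε hε
  obtain ⟨f, hfA, hfg⟩ :=
    ContinuousMap.exists_mem_subalgebra_near_continuous_of_isCompact_of_separatesPoints
      separatesPoints_adjoin_pairMonomials g (hH.prod hH) (show 0 < ε / 3 by positivity)
  have h1 := Metric.tendsto_nhds.1 (tendsto_integral_adjoin hH hμH hfA) (ε / 3) (by positivity)
  have h2 := abs_integral_prod_sub_le hH hμH fun p hp => (hfg p hp).le
  filter_upwards [h1, eventually_momentFilter H μ] with ν h1 ⟨hν, hνH⟩
  have h3 := abs_integral_prod_sub_le hH hνH fun p hp => (hfg p hp).le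
  rw [Real.dist_eq, abs_lt] at h1 ⊢
  rw [abs_le] at h2 h3
  constructor <;> linarith [h1.1, h1.2, h2.1, h2.2, h3.1, h3.2]

/-- The kernel `max (log ‖z - t‖) (-n)`, truncated from below. -/
def truncLog (n : ℕ) : C(ℂ × ℂ, ℝ) where
  toFun p := Real.log (max ‖p.1 - p.2‖ (Real.exp (-n)))
  continuous_toFun := Continuous.log (by fun_prop) fun p =>
    (lt_max_of_lt_right (Real.exp_pos _)).ne'

theorem exp_truncLog (n : ℕ) (p : ℂ × ℂ) :
    Real.exp (truncLog n p) = max ‖p.1 - p.2‖ (Real.exp (-n)) :=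
  Real.exp_log (lt_max_of_lt_right (Real.exp_pos _))

theorem truncLog_self (n : ℕ) (z : ℂ) : truncLog n (z, z) = -n := by
  simp [truncLog, (Real.exp_pos _).le]

theorem truncLog_symm (n : ℕ) (z t : ℂ) : truncLog n (z, t) = truncLog n (t, z) := by
  simp [truncLog, norm_sub_rev]

theorem norm_vdm_le (n d : ℕ) (l : Fin d → ℂ) :
    ‖vdm d l‖ ≤ Real.exp (((∑ i, ∑ j, truncLog n (l i, l j)) + d * n) / 2) := by
  have h1 : ‖vdm d l‖ ≤ Real.exp (∑ i : Fin d, ∑ j ∈ Finset.Ioi i, truncLog n (l i, l j)) := by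
    simp only [vdm, norm_prod, Real.exp_sum, exp_truncLog]
    gcongr
    exact le_max_left _ _
  refine h1.trans_eq (congrArg _ ?_)
  have h2 := Finset.sum_sum_Ioi_add_eq_sum_sum_off_diag fun i j => truncLog n (l i, l j)
  have h3 : ∀ i, ∑ j, truncLog n (l i, l j) =
      -n + ∑ j ∈ {i}ᶜ, truncLog n (l j, l i) := fun i => by
    rw [← Finset.sum_add_sum_compl {i}, Finset.sum_singleton, truncLog_self]
    simp only [truncLog_symm n (l i)]
  have h4 : ∑ i : Fin d, ∑ j ∈ Finset.Ioi i, (truncLog n (l j, l i) + truncLog n (l i, l j)) =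
      2 * ∑ i : Fin d, ∑ j ∈ Finset.Ioi i, truncLog n (l i, l j) := by
    simp only [Finset.mul_sum, two_mul]
    refine Finset.sum_congr rfl fun i _ => Finset.sum_congr rfl fun j _ => ?_
    rw [truncLog_symm n (l j) (l i)]
  simp only [h3, Finset.sum_add_distrib, Finset.sum_const, Finset.card_univ, Fintype.card_fin,
    nsmul_eq_mul]
  rw [← h2, h4]
  ring

theorem integral_empMeasure (d : ℕ) (l : Fin d → ℂ) (f : ℂ → ℝ) :
    ∫ z, f z ∂(empMeasure d l) = (d : ℝ)⁻¹ * ∑ j, f (l j) := by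
  rw [empMeasure, integral_smul_measure, integral_finsetSum_measure fun _ _ =>
    integrable_dirac (by simp)]
  simp

theorem integral_empMeasure_prod {H : Set ℂ} (hH : IsCompact H) {d : ℕ} {l : Fin d → ℂ}
    [IsProbabilityMeasure (empMeasure d l)] (hl : empMeasure d l Hᶜ = 0) (f : C(ℂ × ℂ, ℝ)) :
    ∫ p, f p ∂((empMeasure d l).prod (empMeasure d l)) =
      (d : ℝ)⁻¹ * ((d : ℝ)⁻¹ * ∑ i, ∑ j, f (l i, l j)) := by
  rw [integral_prod _ (integrable_prod_of_continuous hH hl f.continuous)]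
  simp only [integral_empMeasure, Finset.mul_sum]

theorem IsRectangle.isCompact {H : Set ℂ} (hH : IsRectangle H) : IsCompact H := by
  obtain ⟨a, b, c, e, -, -, rfl⟩ := hH
  exact isCompact_Icc.reProdIm isCompact_Icc

theorem limsup_Wd_le {H : Set ℂ} (hH : IsCompact H) {μ : Measure ℂ} {k n : ℕ} {ε c : ℝ}
    (h : ∀ ν ∈ momentNbhd H μ k ε, ∫ p, truncLog n p ∂(ν.prod ν) ≤ c) :
    atTop.limsup (fun d : ℕ => Wd H μ k ε d) ≤ ENNReal.ofReal (Real.exp c) := by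
  have hlim : Tendsto (fun d : ℕ => ENNReal.ofReal (Real.exp (c + (c + n) / ((d : ℝ) - 1)))) atTop
      (𝓝 (ENNReal.ofReal (Real.exp c))) := by
    refine ENNReal.tendsto_ofReal (Real.continuous_exp.tendsto _ |>.comp ?_)
    have : Tendsto (fun d : ℕ => (d : ℝ) - 1) atTop atTop :=
      tendsto_atTop_add_const_right _ _ tendsto_natCast_atTop_atTop
    simpa using tendsto_const_nhds.add (tendsto_const_nhds.div_atTop this)
  rw [← hlim.limsup_eq]
  refine limsup_le_limsup ?_
  filter_upwards [eventually_ge_atTop 2] with d hd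
  have hd' : (2 : ℝ) ≤ d := by exact_mod_cast hd
  have hd1 : 0 < (d : ℝ) - 1 := by linarith
  have hd0 : 0 < (d : ℝ) := by linarith
  refine iSup₂_le fun l hl => ENNReal.ofReal_le_ofReal ?_
  have hprob : IsProbabilityMeasure (empMeasure d l) := hl.2.1
  have hc := h _ hl.2
  rw [integral_empMeasure_prod hH hl.2.2.1, ← mul_assoc, ← mul_inv, inv_mul_le_iff₀ (by positivity)]
    at hc
  refine (Real.rpow_le_rpow (norm_nonneg _) (norm_vdm_le n d l) (by positivity)).trans ?_
  rw [← Real.exp_mul, Real.exp_le_exp, mul_comm, ← le_div_iff₀' (by positivity)]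
  refine (div_le_div_of_nonneg_right (add_le_add_left hc _) zero_le_two).trans_eq ?_
  field_simp
  ring

theorem elog_mono : Monotone elog := by
  intro x y hxy
  rcases eq_or_ne x 0 with rfl | hx
  · simp [elog]
  rcases eq_or_ne y ⊤ with rfl | hy
  · simp [elog]
  have hy0 : y ≠ 0 := (hx.bot_lt.trans_le hxy).ne'
  rw [elog, elog, if_neg hx, if_neg (ne_top_of_le_ne_top hy hxy), if_neg hy0, if_neg hy,
    EReal.coe_le_coe_iff]
  exact Real.log_le_log (ENNReal.toReal_pos hx (ne_top_of_le_ne_top hy hxy))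
    (ENNReal.toReal_mono hy hxy)

theorem elog_ofReal_exp (c : ℝ) : elog (ENNReal.ofReal (Real.exp c)) = c := by
  rw [elog, if_neg (by simpa using Real.exp_pos c), if_neg ENNReal.ofReal_ne_top,
    ENNReal.toReal_ofReal (Real.exp_pos c).le, Real.log_exp]

theorem elog_W_le_integral_truncLog {H : Set ℂ} (hH : IsCompact H) {μ : Measure ℂ}
    [IsProbabilityMeasure μ] (hμH : μ Hᶜ = 0) (n : ℕ) :
    elog (⨅ (k : ℕ) (ε : ℝ) (_ : 0 < ε), atTop.limsup fun d : ℕ => Wd H μ k ε d) ≤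
      ((∫ p, truncLog n p ∂(μ.prod μ) : ℝ) : EReal) := by
  refine EReal.le_of_forall_lt_iff_le.1 fun c hc => ?_
  have hev := (tendsto_integral_momentFilter hH hμH (truncLog n)).eventually_lt_const
    (EReal.coe_lt_coe_iff.1 hc)
  obtain ⟨k, -, hk⟩ := (momentFilter_hasBasis H μ).eventually_iff.1 hev
  rw [← elog_ofReal_exp]
  exact elog_mono (iInf_le_of_le k (iInf₂_le_of_le (1 / (k + 1)) (by positivity)
    (limsup_Wd_le hH fun ν hν => (hk hν).le)))

theorem truncLog_antitone : Antitone truncLog := by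
  intro m n hmn p
  refine Real.log_le_log (lt_max_of_lt_right (Real.exp_pos _)) ?_
  gcongr

theorem ofReal_truncLog_zero (p : ℂ × ℂ) :
    ENNReal.ofReal (truncLog 0 p) = ENNReal.ofReal (Real.log ‖p.1 - p.2‖) := by
  simp only [truncLog, ContinuousMap.coe_mk, CharP.cast_eq_zero, neg_zero, Real.exp_zero]
  rcases le_total ‖p.1 - p.2‖ 1 with h | h
  · rw [max_eq_right h, Real.log_one, ENNReal.ofReal_zero,
      ENNReal.ofReal_of_nonpos (Real.log_nonpos (norm_nonneg _) h)]
  · rw [max_eq_left h]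

theorem truncLog_zero_nonneg (p : ℂ × ℂ) : 0 ≤ truncLog 0 p :=
  Real.log_nonneg (le_max_of_le_right (by simp))

theorem ofReal_neg_log_le_iSup (p : ℂ × ℂ) :
    ENNReal.ofReal (-Real.log ‖p.1 - p.2‖) ≤
      ⨆ n, ENNReal.ofReal (truncLog 0 p - truncLog n p) := by
  rcases eq_or_lt_of_le (norm_nonneg (p.1 - p.2)) with h0 | h0
  · simp [← h0]
  obtain ⟨n, hn⟩ := exists_nat_ge (-Real.log ‖p.1 - p.2‖)
  refine le_iSup_of_le n (ENNReal.ofReal_le_ofReal ?_)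
  have h1 : truncLog n p = Real.log ‖p.1 - p.2‖ := by
    simp only [truncLog, ContinuousMap.coe_mk]
    rw [max_eq_left ((Real.le_log_iff_exp_le h0).1 (by linarith))]
  linarith [truncLog_zero_nonneg p]

/-- A number below all truncated energies of `μ` is below its free entropy. -/
theorem le_freeEntropy {H : Set ℂ} (hH : IsCompact H) {μ : Measure ℂ}
    [IsProbabilityMeasure μ] (hμH : μ Hᶜ = 0) {w : ℝ}
    (hw : ∀ n, w ≤ ∫ p, truncLog n p ∂(μ.prod μ)) : (w : EReal) ≤ freeEntropy μ := by
  have hint : ∀ n, Integrable (truncLog n) (μ.prod μ) := fun n =>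
    integrable_prod_of_continuous hH hμH (truncLog n).continuous
  have hpos : (∫⁻ p : ℂ × ℂ, ENNReal.ofReal (Real.log ‖p.1 - p.2‖) ∂(μ.prod μ)).toReal =
      ∫ p, truncLog 0 p ∂(μ.prod μ) := by
    simp_rw [← ofReal_truncLog_zero]
    exact (integral_eq_lintegral_of_nonneg_ae (ae_of_all _ truncLog_zero_nonneg)
      (hint 0).aestronglyMeasurable).symm
  have hneg : ∫⁻ p : ℂ × ℂ, ENNReal.ofReal (-Real.log ‖p.1 - p.2‖) ∂(μ.prod μ) ≤
      ENNReal.ofReal (∫ p, truncLog 0 p ∂(μ.prod μ) - w) := by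
    refine (lintegral_mono ofReal_neg_log_le_iSup).trans ?_
    have hmono : Monotone fun n p => ENNReal.ofReal (truncLog 0 p - truncLog n p) :=
      fun m n hmn p => ENNReal.ofReal_le_ofReal (sub_le_sub_left (truncLog_antitone hmn p) _)
    rw [lintegral_iSup (fun n => by fun_prop) hmono]
    refine iSup_le fun n => ?_
    have hint' : Integrable (fun p => truncLog 0 p - truncLog n p) (μ.prod μ) :=
      (hint 0).sub (hint n)
    rw [← ofReal_integral_eq_lintegral_ofReal hint'
      (ae_of_all _ fun p => sub_nonneg.2 (truncLog_antitone n.zero_le p)),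
      integral_sub (hint 0) (hint n)]
    exact ENNReal.ofReal_le_ofReal (sub_le_sub_left (hw n) _)
  have hw0 : 0 ≤ ∫ p, truncLog 0 p ∂(μ.prod μ) - w := sub_nonneg.2 (hw 0)
  rw [freeEntropy, hpos]
  refine le_trans ?_ (EReal.sub_le_sub le_rfl (EReal.coe_ennreal_le_coe_ennreal_iff.2 hneg))
  rw [EReal.coe_ennreal_ofReal, max_eq_left hw0, ← EReal.coe_sub, sub_sub_cancel]

/-- inequality (a) in Theorem 4.1, `log W(μ) ≤ Σ(μ)`. -/
theorem log_W_le_freeEntropy (H : Set ℂ) (hH : IsRectangle H)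
    (μ : MeasureTheory.Measure ℂ) [MeasureTheory.IsProbabilityMeasure μ] (hμH : μ Hᶜ = 0) :
    elog (⨅ (k : ℕ) (ε : ℝ) (_ : 0 < ε),
        Filter.atTop.limsup fun d : ℕ => Wd H μ k ε d) ≤ freeEntropy μ := by
  have hle := elog_W_le_integral_truncLog hH.isCompact hμH
  generalize elog _ = x at hle ⊢
  induction x with
  | bot => exact bot_le
  | top => exact absurd (hle 0) (by simp)
  | coe w => exact le_freeEntropy hH.isCompact hμH fun n => EReal.coe_le_coe_iff.1 (hle n)

end
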